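/- Let ν be a finite measure on a measurable space X, let h ∈ L¹(ν), and let α : X × ℝ → ℝ be a Carathéodory function (measurable in x for each Θ, continuous in Θ for a.e. x) with α# ≤ α(x,Θ) ≤ αSharp for all Θ and ν-a.e. x, where 0 < α# ≤ αSharp. Define S(Θ) := ∫ α(x,Θ)·h(x) dν and assume there are constants 0 < m ≤ M with m ≤ S(Θ) ≤ M for all Θ ∈ ℝ. Then for every c > 0 there exists Θ ∈ [c/M, c/m] satisfying the implicit scalar equation Θ·S(Θ) = c. -/

import Mathlib

open MeasureTheory

/-- Solvability of the implicit scalar equation (2.19) of Theorem 2.2: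
`Θ·S(Θ) = c` with `S(Θ) = ∫ α(·,Θ) h dν`, together with the sandwich bounds
`c/M ≤ Θ ≤ c/m` of (2.20). -/
theorem implicit_scalar_equation_solvable
    {X : Type*} [MeasurableSpace X] (ν : Measure X) [IsFiniteMeasure ν]
    (h : X → ℝ) (hh : Integrable h ν)
    (α : X → ℝ → ℝ)
    (hα_meas : ∀ Θ : ℝ, Measurable fun x => α x Θ)
    (hα_cont : ∀ᵐ x ∂ν, Continuous fun Θ => α x Θ)
    (αlow αSharp : ℝ) (hαlow : 0 < αlow) (hαord : αlow ≤ αSharp)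
    (hα_bdd : ∀ᵐ x ∂ν, ∀ Θ : ℝ, αlow ≤ α x Θ ∧ α x Θ ≤ αSharp)
    (m M : ℝ) (hm : 0 < m) (hmM : m ≤ M)
    (hS : ∀ Θ : ℝ, m ≤ ∫ x, α x Θ * h x ∂ν ∧ ∫ x, α x Θ * h x ∂ν ≤ M) :
    ∀ c : ℝ, 0 < c →
      ∃ Θ ∈ Set.Icc (c / M) (c / m), Θ * ∫ x, α x Θ * h x ∂ν = c := by
  intro c hc
  have hM : 0 < M := hm.trans_le hmM
  have hcont : Continuous fun Θ : ℝ => ∫ x, α x Θ * h x ∂ν := by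
    refine continuous_of_dominated (bound := fun x => αSharp * ‖h x‖) (fun Θ => ?_) (fun Θ => ?_)
      (hh.norm.const_mul αSharp) ?_
    · exact (hα_meas Θ).aestronglyMeasurable.mul hh.aestronglyMeasurable
    · filter_upwards [hα_bdd] with x hx
      rw [norm_mul, Real.norm_of_nonneg (hαlow.le.trans (hx Θ).1)]
      exact mul_le_mul_of_nonneg_right (hx Θ).2 (norm_nonneg _)
    · filter_upwards [hα_cont] with x hx
      exact hx.mul continuous_const
  have hle : c / M ≤ c / m := div_le_div_of_nonneg_left hc.le hm hmM
  refine intermediate_value_Icc hle (continuous_id.mul hcont).continuousOn ⟨?_, ?_⟩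
  · calc c / M * ∫ x, α x (c / M) * h x ∂ν ≤ c / M * M :=
          mul_le_mul_of_nonneg_left (hS _).2 (div_pos hc hM).le
      _ = c := div_mul_cancel₀ c hM.ne'
  · calc c = c / m * m := (div_mul_cancel₀ c hm.ne').symm
      _ ≤ c / m * ∫ x, α x (c / m) * h x ∂ν :=
          mul_le_mul_of_nonneg_left (hS _).1 (div_pos hc hm).le
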